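/- Let k be an algebraically closed field and let ν, μ be partitions. For every k[T]-module X admitting a short exact sequence 0 → M(ν,k) → X → M(μ,k) → 0, one has dim_k End_{k[T]}(M(ν+μ,k)) ≤ dim_k End_{k[T]}(X); that is, M(ν+μ,k) is the generic extension M(ν,k) ∗ M(μ,k), the extension of M(ν,k) by M(μ,k) with endomorphism ring of minimal k-dimension. -/

import Mathlib

open Polynomial

/-- A partition: a weakly decreasing sequence of natural numbers with
finitely many nonzero terms (0-indexed: `parts i` is the `(i+1)`-st part). -/
structure PartitionSeq where
  parts : ℕ → ℕ
  antitone : ∀ ⦃i j : ℕ⦄, i ≤ j → parts j ≤ parts i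
  finite_support : {i : ℕ | parts i ≠ 0}.Finite

/-- The nilpotent `k[T]`-module `M(λ, k) = ⊕ᵢ k[T]/(T^{λᵢ})`. -/
abbrev MMod (k : Type) [Field k] (lam : ℕ → ℕ) :=
  DirectSum ℕ (fun i => Polynomial k ⧸ Ideal.span {(X : Polynomial k) ^ lam i})

section MonomialTorsion

variable {k : Type} [Field k]
variable {V : Type*} [AddCommGroup V] [Module k[X] V]
variable {W : Type*} [AddCommGroup W] [Module k[X] W]

theorem map_range_lsmul_le (f : V →ₗ[k[X]] W) (p : k[X]) :
    (LinearMap.range (LinearMap.lsmul k[X] V p)).map f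
      ≤ LinearMap.range (LinearMap.lsmul k[X] W p) := by
  rintro _ ⟨_, ⟨x, rfl⟩, rfl⟩
  exact ⟨f x, (map_smul f p x).symm⟩

variable {U : Type*} [AddCommGroup U] [Module k[X] U]

theorem exists_X_pow_smul_eq_zero_of_exact (f : U →ₗ[k[X]] V) (g : V →ₗ[k[X]] W)
    (hfg : LinearMap.range f = LinearMap.ker g)
    (hU : ∀ x : U, ∃ m : ℕ, (X : k[X]) ^ m • x = 0)
    (hW : ∀ x : W, ∃ m : ℕ, (X : k[X]) ^ m • x = 0) (y : V) :
    ∃ m : ℕ, (X : k[X]) ^ m • y = 0 := by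
  obtain ⟨m₂, hm₂⟩ := hW (g y)
  obtain ⟨x, hx⟩ : (X : k[X]) ^ m₂ • y ∈ LinearMap.range f := by
    rw [hfg, LinearMap.mem_ker, map_smul, hm₂]
  obtain ⟨m₁, hm₁⟩ := hU x
  exact ⟨m₁ + m₂, by rw [pow_add, mul_smul, ← hx, ← map_smul, hm₁, map_zero]⟩

variable [Module k V] [IsScalarTower k k[X] V] [Module k W] [IsScalarTower k k[X] W]

theorem finite_polynomial_submodule [Module.Finite k V] (N : Submodule k[X] V) :
    Module.Finite k N :=
  inferInstanceAs (Module.Finite k (N.restrictScalars k))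

attribute [local instance] finite_polynomial_submodule

theorem finrank_range_add_finrank_ker_polynomial [Module.Finite k V] (f : V →ₗ[k[X]] W) :
    Module.finrank k (LinearMap.range f) + Module.finrank k (LinearMap.ker f)
      = Module.finrank k V :=
  (f.restrictScalars k).finrank_range_add_finrank_ker

theorem finrank_polynomial_submodule_mono [Module.Finite k V] {M N : Submodule k[X] V}
    (h : M ≤ N) : Module.finrank k M ≤ Module.finrank k N :=
  Submodule.finrank_mono (s := M.restrictScalars k) (t := N.restrictScalars k) h

theorem finrank_map_of_injective (f : V →ₗ[k[X]] W) (hf : Function.Injective f)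
    (N : Submodule k[X] V) : Module.finrank k (N.map f) = Module.finrank k N :=
  ((Submodule.equivMapOfInjective f hf N).restrictScalars k).finrank_eq.symm

theorem finrank_le_finrank_map_add_finrank_ker [Module.Finite k V] (f : V →ₗ[k[X]] W)
    (N : Submodule k[X] V) :
    Module.finrank k N ≤ Module.finrank k (N.map f) + Module.finrank k (LinearMap.ker f) := by
  have h := finrank_range_add_finrank_ker_polynomial (k := k) (f.domRestrict N)
  rw [LinearMap.range_domRestrict] at h
  have h' := finrank_map_of_injective (k := k) N.subtype N.injective_subtype
    (LinearMap.ker (f.domRestrict N))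
  have h'' : (LinearMap.ker (f.domRestrict N)).map N.subtype ≤ LinearMap.ker f := by
    rintro _ ⟨x, hx, rfl⟩
    exact hx
  have := finrank_polynomial_submodule_mono (k := k) h''
  omega

variable (k V) in
/-- The dimension of the kernel of multiplication by `X ^ s`. -/
noncomputable def nullityX (s : ℕ) : ℕ :=
  Module.finrank k (LinearMap.ker (LinearMap.lsmul k[X] V (X ^ s)))

variable (k V) in
/-- The dimension of the range of multiplication by `X ^ s`. -/
noncomputable def rankX (s : ℕ) : ℕ :=
  Module.finrank k (LinearMap.range (LinearMap.lsmul k[X] V (X ^ s)))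

theorem rankX_add_nullityX [Module.Finite k V] (s : ℕ) :
    rankX k V s + nullityX k V s = Module.finrank k V :=
  finrank_range_add_finrank_ker_polynomial _

theorem nullityX_le_of_injective [Module.Finite k W] (f : V →ₗ[k[X]] W)
    (hf : Function.Injective f) (s : ℕ) : nullityX k V s ≤ nullityX k W s := by
  rw [nullityX, ← finrank_map_of_injective f hf]
  apply finrank_polynomial_submodule_mono
  rintro _ ⟨x, hx, rfl⟩
  have hx : (X ^ s : k[X]) • x = 0 := hx
  change (X ^ s : k[X]) • f x = 0
  rw [← map_smul, hx, map_zero]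

theorem rankX_le_of_injective [Module.Finite k W] (f : V →ₗ[k[X]] W)
    (hf : Function.Injective f) (s : ℕ) : rankX k V s ≤ rankX k W s := by
  rw [rankX, ← finrank_map_of_injective f hf]
  exact finrank_polynomial_submodule_mono (map_range_lsmul_le f _)

theorem nullityX_congr [Module.Finite k V] [Module.Finite k W] (e : V ≃ₗ[k[X]] W) (s : ℕ) :
    nullityX k V s = nullityX k W s :=
  le_antisymm (nullityX_le_of_injective e.toLinearMap e.injective s)
    (nullityX_le_of_injective e.symm.toLinearMap e.symm.injective s)

theorem nullityX_le_of_surjective [Module.Finite k V] [Module.Finite k W] (f : V →ₗ[k[X]] W)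
    (hf : Function.Surjective f) (s : ℕ) : nullityX k W s ≤ nullityX k V s := by
  have h₁ := finrank_range_add_finrank_ker_polynomial (k := k) f
  rw [LinearMap.range_eq_top.2 hf,
    ((Submodule.topEquiv (R := k[X]) (M := W)).restrictScalars k).finrank_eq] at h₁
  have h₂ := finrank_le_finrank_map_add_finrank_ker (k := k) f
    (LinearMap.range (LinearMap.lsmul k[X] V (X ^ s)))
  have h₃ := finrank_polynomial_submodule_mono (k := k) (map_range_lsmul_le f (X ^ s))
  have h₄ := rankX_add_nullityX (k := k) (V := V) s
  have h₅ := rankX_add_nullityX (k := k) (V := W) s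
  unfold rankX at h₄ h₅
  omega

theorem rankX_le_rankX_succ_add_nullityX_one [Module.Finite k V] (s : ℕ) :
    rankX k V s ≤ rankX k V (s + 1) + nullityX k V 1 := by
  refine (finrank_le_finrank_map_add_finrank_ker (k := k)
    (LinearMap.lsmul k[X] V (X ^ 1)) _).trans (Nat.add_le_add_right ?_ _)
  apply finrank_polynomial_submodule_mono
  rintro _ ⟨_, ⟨x, rfl⟩, rfl⟩
  refine ⟨x, ?_⟩
  simp [smul_smul, pow_succ, mul_comm]

theorem finrank_le_rankX_add_mul_nullityX_one [Module.Finite k V] (s : ℕ) :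
    Module.finrank k V ≤ rankX k V s + s * nullityX k V 1 := by
  induction s with
  | zero =>
    have h : rankX k V 0 = Module.finrank k V := by
      have : LinearMap.range (LinearMap.lsmul k[X] V (X ^ 0)) = ⊤ :=
        LinearMap.range_eq_top.2 fun x => ⟨x, by simp⟩
      rw [rankX, this,
        ((Submodule.topEquiv (R := k[X]) (M := V)).restrictScalars k).finrank_eq]
    simp [h]
  | succ s ih =>
    have := rankX_le_rankX_succ_add_nullityX_one (k := k) (V := V) s
    rw [Nat.succ_mul]
    omega

variable (k) in
/-- The uniserial `k[X]`-module of length `a` supported at the origin. -/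
abbrev QuotXPow (a : ℕ) : Type := k[X] ⧸ Ideal.span {(X : k[X]) ^ a}

instance quotXPow_finite (a : ℕ) : Module.Finite k (QuotXPow k a) :=
  (monic_X_pow a).finite_quotient

theorem finrank_quotXPow (a : ℕ) : Module.finrank k (QuotXPow k a) = a := by
  rw [finrank_quotient_span_eq_natDegree, natDegree_X_pow]

theorem rankX_quotXPow (a s : ℕ) : rankX k (QuotXPow k a) s = a - s := by
  let f : k[X] →ₗ[k[X]] QuotXPow k a :=
    (LinearMap.lsmul k[X] (QuotXPow k a) (X ^ s)).comp (Submodule.mkQ _)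
  have hf (p : k[X]) : f p = Ideal.Quotient.mk _ (X ^ s * p) := rfl
  have hker : LinearMap.ker f = Ideal.span {(X : k[X]) ^ (a - s)} := by
    ext p
    rw [LinearMap.mem_ker, hf, Ideal.Quotient.eq_zero_iff_mem, Ideal.mem_span_singleton,
      Ideal.mem_span_singleton]
    simp only [X_pow_dvd_iff, coeff_X_pow_mul']
    constructor
    · intro h d hd
      simpa using h (d + s) (by omega)
    · intro h d hd
      split_ifs with hs
      · exact h _ (by omega)
      · rfl
  have hrange : LinearMap.range f
      = LinearMap.range (LinearMap.lsmul k[X] (QuotXPow k a) (X ^ s)) :=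
    LinearMap.range_comp_of_range_eq_top _ (Submodule.range_mkQ _)
  rw [rankX, ← hrange, ← (f.quotKerEquivRange.restrictScalars k).finrank_eq, hker]
  exact finrank_quotXPow _

theorem nullityX_quotXPow (a s : ℕ) : nullityX k (QuotXPow k a) s = min a s := by
  have := rankX_add_nullityX (k := k) (V := QuotXPow k a) s
  rw [rankX_quotXPow, finrank_quotXPow] at this
  omega

variable {ι : Type*} [Fintype ι]

theorem nullityX_pi (V : ι → Type*) [∀ i, AddCommGroup (V i)] [∀ i, Module k[X] (V i)]
    [∀ i, Module k (V i)] [∀ i, IsScalarTower k k[X] (V i)] [∀ i, Module.Finite k (V i)]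
    (s : ℕ) : nullityX k (∀ i, V i) s = ∑ i, nullityX k (V i) s := by
  let e : LinearMap.ker (LinearMap.lsmul k[X] (∀ i, V i) (X ^ s)) ≃ₗ[k]
      ∀ i, LinearMap.ker (LinearMap.lsmul k[X] (V i) (X ^ s)) :=
    { toFun x i := ⟨x.1 i, congrFun (show (X ^ s : k[X]) • x.1 = 0 from x.2) i⟩
      invFun y := ⟨fun i => (y i).1, funext fun i => (y i).2⟩
      map_add' _ _ := rfl
      map_smul' _ _ := rfl
      left_inv _ := rfl
      right_inv _ := rfl }
  rw [nullityX, e.finrank_eq, Module.finrank_pi_fintype]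
  rfl

theorem nullityX_pi_quotXPow (a : ι → ℕ) (s : ℕ) :
    nullityX k (∀ i, QuotXPow k (a i)) s = ∑ i, min (a i) s := by
  simp only [nullityX_pi, nullityX_quotXPow]

theorem finrank_pi_quotXPow (a : ι → ℕ) :
    Module.finrank k (∀ i, QuotXPow k (a i)) = ∑ i, a i := by
  rw [Module.finrank_pi_fintype]
  simp only [finrank_quotXPow]

theorem rankX_pi_quotXPow (a : ι → ℕ) (s : ℕ) :
    rankX k (∀ i, QuotXPow k (a i)) s = ∑ i, (a i - s) := by
  have h := rankX_add_nullityX (k := k) (V := ∀ i, QuotXPow k (a i)) s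
  have h' : ∑ i, (a i - s) + ∑ i, min (a i) s = ∑ i, a i := by
    rw [← Finset.sum_add_distrib]
    exact Finset.sum_congr rfl fun i _ => by omega
  rw [nullityX_pi_quotXPow, finrank_pi_quotXPow] at h
  omega

/-- Homomorphisms out of `k[X] ⧸ (X ^ a)` are determined by an element killed by `X ^ a`. -/
noncomputable def homQuotXPowEquiv (a : ℕ) :
    (QuotXPow k a →ₗ[k[X]] V) ≃ₗ[k] LinearMap.ker (LinearMap.lsmul k[X] V (X ^ a)) where
  toFun f := ⟨f (Submodule.Quotient.mk 1), by
    rw [LinearMap.mem_ker, LinearMap.lsmul_apply, ← map_smul, ← Submodule.Quotient.mk_smul,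
      (Submodule.Quotient.mk_eq_zero _).2, map_zero]
    exact Ideal.mem_span_singleton.2 (by simp)⟩
  invFun x := Submodule.liftQ _ (LinearMap.toSpanSingleton k[X] V x.1) (by
    rw [Ideal.span, Submodule.span_singleton_le_iff_mem]
    exact x.2)
  map_add' _ _ := rfl
  map_smul' _ _ := rfl
  left_inv f := by
    ext
    simp
  right_inv x := by
    ext
    exact one_smul k[X] x.1

theorem finrank_pi_quotXPow_hom [Module.Finite k V] (a : ι → ℕ) :
    Module.finrank k ((∀ i, QuotXPow k (a i)) →ₗ[k[X]] V) = ∑ i, nullityX k V (a i) := by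
  classical
  have (i : ι) : Module.Finite k (QuotXPow k (a i) →ₗ[k[X]] V) :=
    .equiv (homQuotXPowEquiv (a i)).symm
  rw [← (LinearMap.lsum k[X] (fun i => QuotXPow k (a i)) k).finrank_eq,
    Module.finrank_pi_fintype]
  exact Finset.sum_congr rfl fun i _ => (homQuotXPowEquiv (a i)).finrank_eq

theorem finrank_end_of_equiv_pi (a : ι → ℕ) (e : V ≃ₗ[k[X]] ∀ i, QuotXPow k (a i)) :
    Module.finrank k (Module.End k[X] V) = ∑ i, ∑ j, min (a j) (a i) := by
  rw [(e.conj.restrictScalars k).finrank_eq, finrank_pi_quotXPow_hom]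
  simp only [nullityX_pi_quotXPow]

theorem finrank_le_sum_range_of_injective [Module.Finite k V] {a : ℕ → ℕ} (ha : Antitone a)
    {n r : ℕ} (hr : r ≤ n) (f : V →ₗ[k[X]] ∀ i : Fin n, QuotXPow k (a i))
    (hf : Function.Injective f) (hV : nullityX k V 1 ≤ r) :
    Module.finrank k V ≤ ∑ i ∈ Finset.range r, a i := by
  have h₁ := finrank_le_rankX_add_mul_nullityX_one (k := k) (V := V) (a r)
  have h₂ := rankX_le_of_injective (k := k) f hf (a r)
  rw [rankX_pi_quotXPow, ← Finset.sum_range fun i => a i - a r] at h₂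
  have h₃ : ∑ i ∈ Finset.range n, (a i - a r) = ∑ i ∈ Finset.range r, (a i - a r) := by
    refine (Finset.sum_subset (Finset.range_mono hr) fun i _ hi => ?_).symm
    exact Nat.sub_eq_zero_of_le (ha (by simpa using hi))
  have h₄ : ∑ i ∈ Finset.range r, (a i - a r) + a r * r = ∑ i ∈ Finset.range r, a i := by
    rw [mul_comm, ← smul_eq_mul, ← Finset.card_range r, ← Finset.sum_const,
      Finset.card_range, ← Finset.sum_add_distrib]
    refine Finset.sum_congr rfl fun i hi => Nat.sub_add_cancel (ha ?_)
    exact (Finset.mem_range.1 hi).le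
  have h₅ := Nat.mul_le_mul_left (a r) hV
  omega

theorem finrank_submodule_le_of_exact [Module.Finite k V] {a b : ℕ → ℕ} (ha : Antitone a)
    (hb : Antitone b) {n r : ℕ} (hr : r ≤ n)
    (f : (∀ i : Fin n, QuotXPow k (a i)) →ₗ[k[X]] V)
    (g : V →ₗ[k[X]] ∀ i : Fin n, QuotXPow k (b i)) (hf : Function.Injective f)
    (hfg : LinearMap.range f = LinearMap.ker g) (U : Submodule k[X] V)
    (hU : nullityX k U 1 ≤ r) :
    Module.finrank k U ≤ ∑ i ∈ Finset.range r, (a i + b i) := by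
  have h₁ : nullityX k (U.comap f) 1 ≤ r :=
    (nullityX_le_of_injective (f.restrict (p := U.comap f) (q := U) fun _ hx => hx)
      (fun x y hxy => Subtype.ext (hf (congrArg Subtype.val hxy))) 1).trans hU
  have h₂ : nullityX k (U.map g) 1 ≤ r :=
    (nullityX_le_of_surjective (g.submoduleMap U) (g.submoduleMap_surjective U) 1).trans hU
  have h₃ := finrank_le_sum_range_of_injective ha hr (U.comap f).subtype
    (U.comap f).injective_subtype h₁
  have h₄ := finrank_le_sum_range_of_injective hb hr (U.map g).subtype
    (U.map g).injective_subtype h₂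
  have h₅ := finrank_range_add_finrank_ker_polynomial (k := k) (g.domRestrict U)
  rw [LinearMap.range_domRestrict] at h₅
  have h₆ := finrank_map_of_injective (k := k) U.subtype U.injective_subtype
    (LinearMap.ker (g.domRestrict U))
  have h₇ := finrank_map_of_injective (k := k) f hf (U.comap f)
  have h₈ : (LinearMap.ker (g.domRestrict U)).map U.subtype ≤ (U.comap f).map f := by
    rintro _ ⟨x, hx, rfl⟩
    obtain ⟨y, hy⟩ : x.1 ∈ LinearMap.range f := hfg ▸ hx
    exact ⟨y, (Submodule.mem_comap.2 (hy ▸ x.2 : f y ∈ U)), hy⟩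
  have h₉ := finrank_polynomial_submodule_mono (k := k) h₈
  rw [Finset.sum_add_distrib]
  omega

theorem sum_min_add_le_sum_min_of_exact {a b : ℕ → ℕ} (ha : Antitone a) (hb : Antitone b)
    {n d : ℕ} (hd : d ≤ n) (c : Fin d → ℕ)
    (f : (∀ i : Fin n, QuotXPow k (a i)) →ₗ[k[X]] ∀ j, QuotXPow k (c j))
    (g : (∀ j, QuotXPow k (c j)) →ₗ[k[X]] ∀ i : Fin n, QuotXPow k (b i))
    (hf : Function.Injective f) (hg : Function.Surjective g)
    (hfg : LinearMap.range f = LinearMap.ker g) (s : ℕ) :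
    ∑ i : Fin n, min (a i + b i) s ≤ ∑ j, min (c j) s := by
  classical
  let S : Finset (Fin d) := Finset.univ.filter fun j => s < c j
  let U : Submodule k[X] (∀ j, QuotXPow k (c j)) :=
    ⨅ j ∈ {j | c j ≤ s}, LinearMap.ker (LinearMap.proj j)
  let e : U ≃ₗ[k[X]] ∀ j : {j | s < c j}, QuotXPow k (c j) :=
    LinearMap.iInfKerProjEquiv k[X] (fun j => QuotXPow k (c j))
      (Set.disjoint_left.2 fun j (h : s < c j) (h' : c j ≤ s) => by omega)
      (fun j _ => (lt_or_ge s (c j)).imp id id)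
  have sum_eq (h : ℕ → ℕ) : ∑ j : {j | s < c j}, h (c j) = ∑ j ∈ S, h (c j) :=
    (Finset.sum_subtype S (fun j => by simp [S]) fun j => h (c j)).symm
  have hUd : Module.finrank k U = ∑ j ∈ S, c j := by
    rw [(e.restrictScalars k).finrank_eq, finrank_pi_quotXPow]
    exact sum_eq id
  have hU : nullityX k U 1 ≤ S.card := by
    rw [nullityX_congr e, nullityX_pi_quotXPow, sum_eq fun m => min m 1, Finset.card_eq_sum_ones]
    exact Finset.sum_le_sum fun j _ => min_le_right _ _
  have hSd : S.card ≤ d := by simpa using S.card_le_univ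
  have hSn := hSd.trans hd
  have h₁ := finrank_submodule_le_of_exact ha hb hSn f g hf hfg U hU
  have h₂ : ∑ j, c j = ∑ i : Fin n, (a i + b i) := by
    have := finrank_range_add_finrank_ker_polynomial (k := k) g
    rw [← hfg, LinearMap.range_eq_top.2 hg,
      ((Submodule.topEquiv (R := k[X])).restrictScalars k).finrank_eq,
      ← ((LinearEquiv.ofInjective f hf).restrictScalars k).finrank_eq,
      finrank_pi_quotXPow, finrank_pi_quotXPow, finrank_pi_quotXPow] at this
    rw [Finset.sum_add_distrib]
    omega
  have h₃ : ∑ j, min (c j) s + ∑ j ∈ S, (c j - s) = ∑ j, c j := by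
    rw [Finset.sum_filter, ← Finset.sum_add_distrib]
    refine Finset.sum_congr rfl fun j _ => ?_
    split_ifs <;> omega
  have h₄ : ∑ j ∈ S, (c j - s) + S.card * s = ∑ j ∈ S, c j := by
    rw [← smul_eq_mul, ← Finset.sum_const, ← Finset.sum_add_distrib]
    exact Finset.sum_congr rfl fun j hj => Nat.sub_add_cancel (Finset.mem_filter.1 hj).2.le
  have h₅ : ∑ i : Fin n, min (a i + b i) s + ∑ i ∈ Finset.range n, (a i + b i - s)
      = ∑ i : Fin n, (a i + b i) := by
    rw [Finset.sum_range, ← Finset.sum_add_distrib]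
    exact Finset.sum_congr rfl fun i _ => by omega
  have h₆ : ∑ i ∈ Finset.range S.card, (a i + b i - s)
      ≤ ∑ i ∈ Finset.range n, (a i + b i - s) :=
    Finset.sum_le_sum_of_subset (Finset.range_mono hSn)
  have h₇ : ∑ i ∈ Finset.range S.card, (a i + b i)
      ≤ ∑ i ∈ Finset.range S.card, (a i + b i - s) + S.card * s := by
    rw [← smul_eq_mul]
    nth_rewrite 3 [← Finset.card_range S.card]
    rw [← Finset.sum_const, ← Finset.sum_add_distrib]
    exact Finset.sum_le_sum fun i _ => by omega
  omega

variable (k) in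
/-- Summands of exponent zero may be discarded from a direct sum of uniserial modules. -/
noncomputable def mModEquivPi (a : ℕ → ℕ) (n : ℕ) (ha : ∀ i, n ≤ i → a i = 0) :
    MMod k a ≃ₗ[k[X]] ∀ i : Fin n, QuotXPow k (a i) :=
  LinearEquiv.ofBijective
    (LinearMap.pi fun i : Fin n => DirectSum.component k[X] ℕ (fun i => QuotXPow k (a i)) i) <| by
    constructor
    · intro x y hxy
      ext i
      by_cases hi : i < n
      · exact congrFun hxy ⟨i, hi⟩
      · have : Subsingleton (QuotXPow k (a i)) := by
          rw [ha i (not_lt.1 hi)]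
          exact Ideal.Quotient.subsingleton_iff.2 (by simp)
        exact Subsingleton.elim _ _
    · intro y
      classical
      let z (i : (Finset.range n : Set ℕ)) : QuotXPow k (a i) := y ⟨i, Finset.mem_range.1 i.2⟩
      refine ⟨DirectSum.mk (fun i => QuotXPow k (a i)) (Finset.range n) z, funext fun i => ?_⟩
      exact DirectSum.mk_apply_of_mem (β := fun i => QuotXPow k (a i)) (f := z)
        (Finset.mem_range.2 i.2)

theorem exists_equiv_pi_quotXPow [Module.Finite k V]
    (h : ∀ x : V, ∃ n : ℕ, (X : k[X]) ^ n • x = 0) :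
    ∃ (d : ℕ) (c : Fin d → ℕ), Nonempty (V ≃ₗ[k[X]] ∀ j, QuotXPow k (c j)) := by
  have : Module.Finite k[X] V := .of_restrictScalars_finite k k[X] V
  obtain ⟨d, c, ⟨e⟩⟩ := Module.torsion_by_prime_power_decomposition (p := (X : k[X]))
    irreducible_X ((Submodule.isTorsion'_powers_iff _).2 h)
  exact ⟨d, c, ⟨e.trans (DirectSum.linearEquivFunOnFintype k[X] (Fin d) _)⟩⟩

theorem finite_of_exact_polynomial [Module k U] [IsScalarTower k k[X] U] [Module.Finite k U]
    [Module.Finite k W] (f : U →ₗ[k[X]] V) (g : V →ₗ[k[X]] W)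
    (hfg : LinearMap.range f = LinearMap.ker g) : Module.Finite k V := by
  let g' := g.restrictScalars k
  have h : LinearMap.ker g' = LinearMap.range (f.restrictScalars k) := by
    ext x
    exact (SetLike.ext_iff.1 hfg x).symm
  have : Module.Finite k (LinearMap.ker g') := by
    rw [h]
    infer_instance
  have : Module.Finite k (V ⧸ LinearMap.ker g') := .equiv g'.quotKerEquivRange.symm
  exact .of_submodule_quotient (LinearMap.ker g')

theorem exists_X_pow_smul_eq_zero_of_equiv_pi {V : Type*} [AddCommGroup V]
    [Module k[X] V] (a : ι → ℕ) (e : V ≃ₗ[k[X]] ∀ i, QuotXPow k (a i)) (x : V) :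
    ∃ m : ℕ, (X : k[X]) ^ m • x = 0 := by
  refine ⟨∑ i, a i, e.injective (funext fun i => ?_)⟩
  obtain ⟨p, hp⟩ := Submodule.Quotient.mk_surjective _ (e x i)
  rw [map_smul, map_zero, Pi.smul_apply, ← hp, ← Submodule.Quotient.mk_smul]
  refine (Submodule.Quotient.mk_eq_zero _).2 (Ideal.mem_span_singleton.2 ?_)
  exact (pow_dvd_pow _ (Finset.single_le_sum (fun _ _ => Nat.zero_le _)
    (Finset.mem_univ i))).mul_right p

theorem PartitionSeq.exists_forall_parts_eq_zero (ν : PartitionSeq) :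
    ∃ n, ∀ i, n ≤ i → ν.parts i = 0 := by
  obtain ⟨n, hn⟩ := ν.finite_support.bddAbove
  refine ⟨n + 1, fun i hi => ?_⟩
  by_contra h
  have := hn h
  omega

end MonomialTorsion

/-- `M(ν+μ, k)` is the generic extension of `M(ν,k)` by `M(μ,k)`: among all
extensions `X` of `M(μ,k)` by `M(ν,k)`, the `k`-dimension of its endomorphism
ring `End_{k[T]}` is minimal. -/
theorem finrank_end_sum_le (k : Type) [Field k] [IsAlgClosed k] (ν μ : PartitionSeq)
    (Y : Type) [AddCommGroup Y] [Module (Polynomial k) Y]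
    [Module k Y] [IsScalarTower k (Polynomial k) Y]
    (h : ∃ (f : MMod k ν.parts →ₗ[Polynomial k] Y)
           (g : Y →ₗ[Polynomial k] MMod k μ.parts),
           Function.Injective f ∧ Function.Surjective g ∧
           LinearMap.range f = LinearMap.ker g) :
    Module.finrank k (Module.End (Polynomial k) (MMod k (fun i => ν.parts i + μ.parts i)))
      ≤ Module.finrank k (Module.End (Polynomial k) Y) := by
  obtain ⟨f, g, hf, hg, hfg⟩ := h
  obtain ⟨n₁, hn₁⟩ := ν.exists_forall_parts_eq_zero
  obtain ⟨n₂, hn₂⟩ := μ.exists_forall_parts_eq_zero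
  let e₁ := mModEquivPi k ν.parts n₁ hn₁
  let e₂ := mModEquivPi k μ.parts n₂ hn₂
  have : Module.Finite k (MMod k ν.parts) := .equiv (e₁.restrictScalars k).symm
  have : Module.Finite k (MMod k μ.parts) := .equiv (e₂.restrictScalars k).symm
  have hfin : Module.Finite k Y :=
    finite_of_exact_polynomial (U := MMod k ν.parts) (W := MMod k μ.parts) f g hfg
  have htors : ∀ y : Y, ∃ m : ℕ, (X : k[X]) ^ m • y = 0 :=
    exists_X_pow_smul_eq_zero_of_exact (U := MMod k ν.parts) (W := MMod k μ.parts) f g hfg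
      (exists_X_pow_smul_eq_zero_of_equiv_pi (V := MMod k ν.parts) _ e₁)
      (exists_X_pow_smul_eq_zero_of_equiv_pi (V := MMod k μ.parts) _ e₂)
  obtain ⟨d, c, ⟨e⟩⟩ := exists_equiv_pi_quotXPow htors
  obtain ⟨n, hn₁n, hn₂n, hdn⟩ : ∃ n, n₁ ≤ n ∧ n₂ ≤ n ∧ d ≤ n :=
    ⟨n₁ + n₂ + d, by omega, by omega, by omega⟩
  let eν := mModEquivPi k ν.parts n fun i hi => hn₁ i (hn₁n.trans hi)
  let eμ := mModEquivPi k μ.parts n fun i hi => hn₂ i (hn₂n.trans hi)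
  have key := sum_min_add_le_sum_min_of_exact (k := k) ν.antitone μ.antitone hdn c
    (e.toLinearMap ∘ₗ f ∘ₗ eν.symm.toLinearMap) (eμ.toLinearMap ∘ₗ g ∘ₗ e.symm.toLinearMap)
    (e.injective.comp (hf.comp eν.symm.injective)) (eμ.surjective.comp (hg.comp e.symm.surjective))
    (by
      ext y
      have hy : e.symm y ∈ LinearMap.range f ↔ e.symm y ∈ LinearMap.ker g := by rw [hfg]
      simp only [LinearMap.mem_range, LinearMap.mem_ker, LinearMap.comp_apply,
        LinearEquiv.coe_coe, LinearEquiv.map_eq_zero_iff] at hy ⊢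
      rw [← hy]
      constructor
      · rintro ⟨x, rfl⟩
        exact ⟨eν.symm x, by simp⟩
      · rintro ⟨x, hx⟩
        exact ⟨eν x, by simp [hx]⟩)
  let eνμ := mModEquivPi k (fun i => ν.parts i + μ.parts i) n fun i hi => by
    rw [hn₁ i (hn₁n.trans hi), hn₂ i (hn₂n.trans hi)]
  rw [finrank_end_of_equiv_pi (V := MMod k fun i => ν.parts i + μ.parts i) _ eνμ,
    finrank_end_of_equiv_pi c e]
  calc _ ≤ ∑ i : Fin n, ∑ j, min (c j) (ν.parts i + μ.parts i) :=
        Finset.sum_le_sum fun i _ => key _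
    _ = ∑ j, ∑ i : Fin n, min (ν.parts i + μ.parts i) (c j) := by
        rw [Finset.sum_comm]
        simp only [min_comm]
    _ ≤ _ := Finset.sum_le_sum fun j _ => key _
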